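/- arXiv:1102.3681 — 4 statements merged into one kernel-verified Lean document; each statement's English description precedes it below -/
import Mathlib

section
/- Let g : (0,∞) → ℝ be convex and differentiable (so that g' is continuous on (0,∞)). Suppose that for every (p₀,p₁,p₂) ∈ (0,1)³ one has g'(p₂/p₀) − g'((1−p₂)/(1−p₀)) = g'(p₁/p₀) − g'((1−p₁)/(1−p₀)) + g'(p₂/p₁) − g'((1−p₂)/(1−p₁)). Then g'(x·y) = g'(x) + g'(y) − g'(1) for all x, y > 0. -/
/-- A function that is monotone on a neighbourhood of `a`, and whose image of that neighbourhood is
order-connected, is continuous at `a`. -/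
theorem MonotoneOn.continuousAt_of_ordConnected_image {α β : Type*} [LinearOrder α]
    [TopologicalSpace α] [OrderTopology α] [LinearOrder β] [TopologicalSpace β] [OrderTopology β]
    [DenselyOrdered β] {f : α → β} {s : Set α} {a : α} (hf : MonotoneOn f s) (hs : s ∈ nhds a)
    (himg : (f '' s).OrdConnected) : ContinuousAt f a := by
  have ha : a ∈ s := mem_of_mem_nhds hs
  refine tendsto_order.2 ⟨fun b hb => ?_, fun b hb => ?_⟩
  · by_cases h : ∀ x ∈ s, b < f x
    · filter_upwards [hs] with x hx using h x hx
    push Not at h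
    obtain ⟨y, hy, hyb⟩ := h
    obtain ⟨m, hbm, hma⟩ := exists_between hb
    obtain ⟨c, hc, rfl⟩ := himg.out (Set.mem_image_of_mem f hy) (Set.mem_image_of_mem f ha)
      ⟨hyb.trans hbm.le, hma.le⟩
    filter_upwards [hs, lt_mem_nhds (hf.reflect_lt hc ha hma)] with x hx hcx
    exact hbm.trans_le (hf hc hx hcx.le)
  · by_cases h : ∀ x ∈ s, f x < b
    · filter_upwards [hs] with x hx using h x hx
    push Not at h
    obtain ⟨y, hy, hyb⟩ := h
    obtain ⟨m, ham, hmb⟩ := exists_between hb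
    obtain ⟨c, hc, rfl⟩ := himg.out (Set.mem_image_of_mem f ha) (Set.mem_image_of_mem f hy)
      ⟨ham.le, hmb.le.trans hyb⟩
    filter_upwards [hs, gt_mem_nhds (hf.reflect_lt ha hc ham)] with x hx hxc
    exact (hf hx hc hxc.le).trans_lt hmb

/-- The derivative of a differentiable convex function on an open set is continuous. -/
theorem ConvexOn.continuousAt_of_hasDerivAt {f f' : ℝ → ℝ} {s : Set ℝ} {a : ℝ}
    (hf : ConvexOn ℝ s f) (hf' : ∀ x ∈ s, HasDerivAt f (f' x) x) (hs : s ∈ nhds a) :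
    ContinuousAt f' a := by
  have hmono : MonotoneOn f' s :=
    (hf.monotoneOn_deriv fun x hx => (hf' x hx).differentiableAt).congr
      fun x hx => (hf' x hx).deriv
  exact hmono.continuousAt_of_ordConnected_image hs
    (hf.1.ordConnected.image_hasDerivWithinAt fun x hx => (hf' x hx).hasDerivWithinAt)



/-- The functional-equation step of the main theorem: if the first-order
identity holds over all `(p₀,p₁,p₂) ∈ (0,1)³`, then `g'(xy) = g'(x) + g'(y) − g'(1)`
for all `x, y > 0`. -/
theorem functional_equation_step
    (g g' : ℝ → ℝ)
    (hconv : ConvexOn ℝ (Set.Ioi (0:ℝ)) g)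
    (hderiv : ∀ x ∈ Set.Ioi (0:ℝ), HasDerivAt g (g' x) x)
    (heq : ∀ p₀ ∈ Set.Ioo (0:ℝ) 1, ∀ p₁ ∈ Set.Ioo (0:ℝ) 1, ∀ p₂ ∈ Set.Ioo (0:ℝ) 1,
      g' (p₂ / p₀) - g' ((1 - p₂) / (1 - p₀))
        = g' (p₁ / p₀) - g' ((1 - p₁) / (1 - p₀))
          + (g' (p₂ / p₁) - g' ((1 - p₂) / (1 - p₁)))) :
    ∀ x > (0:ℝ), ∀ y > (0:ℝ), g' (x * y) = g' x + g' y - g' 1 := by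
  intro x hx y hy
  have hxy : 0 < x * y := mul_pos hx hy
  have hcont : ContinuousAt g' 1 :=
    hconv.continuousAt_of_hasDerivAt hderiv (Ioi_mem_nhds one_pos)
  have hlim (a b : ℝ) : Filter.Tendsto (fun t : ℝ => g' ((1 - t * a) / (1 - t * b)))
      (nhdsWithin 0 (Set.Ioi 0)) (nhds (g' 1)) := by
    have hq : ContinuousAt (fun t : ℝ => (1 - t * a) / (1 - t * b)) 0 :=
      ContinuousAt.div (by fun_prop) (by fun_prop) (by simp)
    have hq' : Filter.Tendsto (fun t : ℝ => (1 - t * a) / (1 - t * b)) (nhds 0) (nhds 1) := by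
      simpa [ContinuousAt] using hq
    exact (hcont.tendsto.comp hq').mono_left nhdsWithin_le_nhds
  have hsmall (a : ℝ) : ∀ᶠ t : ℝ in nhdsWithin 0 (Set.Ioi 0), t * a < 1 := by
    have h : ContinuousAt (fun t : ℝ => t * a) 0 := by fun_prop
    exact (h.eventually_lt continuousAt_const (by simp)).filter_mono nhdsWithin_le_nhds
  have hev : ∀ᶠ t : ℝ in nhdsWithin 0 (Set.Ioi 0),
      g' (x * y) - g' ((1 - t * (x * y)) / (1 - t * 1))
        = g' x - g' ((1 - t * x) / (1 - t * 1))
          + (g' y - g' ((1 - t * (x * y)) / (1 - t * x))) := by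
    filter_upwards [self_mem_nhdsWithin, hsmall 1, hsmall x, hsmall (x * y)] with t ht h1 h2 h3
    have ht : 0 < t := ht
    have h := heq t ⟨ht, by simpa using h1⟩ (t * x) ⟨mul_pos ht hx, h2⟩
      (t * (x * y)) ⟨mul_pos ht hxy, h3⟩
    rw [mul_div_cancel_left₀ _ ht.ne', mul_div_cancel_left₀ _ ht.ne', ← mul_assoc t x y,
      mul_div_cancel_left₀ _ (mul_pos ht hx).ne', mul_assoc] at h
    simpa only [mul_one] using h
  have hl := (hlim (x * y) 1).const_sub (g' (x * y))
  have hr := ((hlim x 1).const_sub (g' x)).add ((hlim (x * y) x).const_sub (g' y))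
  have := tendsto_nhds_unique_of_eventuallyEq hl hr hev
  linarith
end

section
/- Let (𝕐, 𝒴) be a measurable space, P a probability measure on 𝒴, and h : 𝕐 → ℝ a measurable function with 0 < Z := ∫ e^{−h(y)} P(dy) < ∞. Define the probability measure P_I on 𝒴 by P_I(A) = (1/Z)·∫_A e^{−h(y)} P(dy). Then for every probability measure λ on 𝒴 with λ ≪ P and with h λ-integrable, the cumulative loss L̄(λ) = ∫ h(y) λ(dy) + D(λ,P) satisfies L̄(λ) = D(λ, P_I) − ln(Z), where both sides take values in (−∞, ∞]. -/
open MeasureTheory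
open scoped Classical

/-- Kullback–Leibler divergence `D(μ,ν) = ∫ ln(dμ/dν) dμ`, valued in `(−∞,∞]`
(it equals `⊤` when `μ ≪ ν` fails or the integral is not defined). -/

noncomputable def KLdiv {Y : Type} [MeasurableSpace Y] (μ ν : Measure Y) : EReal :=
  if μ ≪ ν ∧ Integrable (fun y => Real.log ((μ.rnDeriv ν y).toReal)) μ
  then ((∫ y, Real.log ((μ.rnDeriv ν y).toReal) ∂μ : ℝ) : EReal)
  else ⊤

/-- The exponentially tilted measure as a normalized measure with density. -/
theorem tilted_eq_smul_withDensity {Y : Type} [MeasurableSpace Y] (P : Measure Y) (f : Y → ℝ)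
    (hf : Measurable f) (hpos : 0 < ∫ y, Real.exp (f y) ∂P) :
    P.tilted f = (ENNReal.ofReal (∫ y, Real.exp (f y) ∂P))⁻¹ •
      P.withDensity (fun y => ENNReal.ofReal (Real.exp (f y))) := by
  rw [← withDensity_smul _ (by fun_prop), Measure.tilted]
  congr 1
  funext y
  rw [Pi.smul_apply, smul_eq_mul, ENNReal.ofReal_div_of_pos hpos, div_eq_mul_inv, mul_comm]

/-- With `P_I(A) = (1/Z)·∫_A e^{−h} dP`, `Z = ∫ e^{−h} dP ∈ (0,∞)`, the
cumulative loss satisfies `∫ h dλ + D(λ,P) = D(λ,P_I) − ln(Z)` for every probability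
measure `λ ≪ P` with `h` λ-integrable; both sides are valued in `(−∞,∞]`. -/
theorem cumulative_loss_identity
    {Y : Type} [MeasurableSpace Y] (P : Measure Y) [IsProbabilityMeasure P]
    (h : Y → ℝ) (hmeas : Measurable h)
    (hint : Integrable (fun y => Real.exp (-h y)) P)
    (Z : ℝ) (hZdef : Z = ∫ y, Real.exp (-h y) ∂P) (hZpos : 0 < Z)
    (PI : Measure Y)
    (hPIdef : PI = (ENNReal.ofReal Z)⁻¹ •
      P.withDensity (fun y => ENNReal.ofReal (Real.exp (-h y))))
    (lam : Measure Y) [IsProbabilityMeasure lam] (hac : lam ≪ P)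
    (hhl : Integrable h lam) :
    ((∫ y, h y ∂lam : ℝ) : EReal) + KLdiv lam P
      = KLdiv lam PI - ((Real.log Z : ℝ) : EReal) := by
  have hPI : PI = P.tilted (fun y => -h y) := by
    rw [hPIdef, hZdef, tilted_eq_smul_withDensity P (fun y => -h y) hmeas.neg (hZdef ▸ hZpos)]
  have hacI : lam ≪ PI := hPI ▸ hac.trans (absolutelyContinuous_tilted hint)
  have hllr : llr lam PI =ᵐ[lam] fun y => (h y + Real.log Z) + llr lam P y := by
    simpa [hPI, hZdef] using llr_tilted_right hac hint
  have hconst : Integrable (fun y => h y + Real.log Z) lam := hhl.add (integrable_const _)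
  have hiff : Integrable (llr lam PI) lam ↔ Integrable (llr lam P) lam := by
    rw [integrable_congr hllr]
    exact integrable_add_iff_integrable_right' hconst
  unfold KLdiv
  simp only [← llr.eq_1, hac, hacI, true_and, hiff]
  split_ifs with hi
  · have hval : ∫ y, llr lam PI y ∂lam = ∫ y, llr lam P y ∂lam - ∫ y, -h y ∂lam + Real.log Z := by
      rw [hPI, hZdef]
      exact integral_llr_tilted_right hac hhl.neg hint hi
    rw [hval, integral_neg]
    norm_cast
    ring
  · rw [EReal.coe_add_top, EReal.top_sub_coe]
end

section
/- Let (𝕐, 𝒴) be a measurable space, P a probability measure on 𝒴, and h : 𝕐 → ℝ a measurable function with 0 < Z := ∫ e^{−h(y)} P(dy) < ∞. Define P_I(A) = (1/Z)·∫_A e^{−h(y)} P(dy). Then for every probability measure λ on 𝒴 with λ ≪ P and with h λ-integrable, ∫ h dλ + D(λ,P) ≥ −ln(Z), with equality if and only if λ = P_I. In particular, P_I is the unique minimizer of the cumulative loss λ ↦ ∫ h dλ + D(λ,P) over probability measures λ ≪ P. -/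
open MeasureTheory
open scoped Classical

lemma smul_withDensity_exp_eq_tilted {Y : Type*} [MeasurableSpace Y] {P : Measure Y}
    [NeZero P] {f : Y → ℝ} (hf : Measurable f)
    (hint : Integrable (fun y => Real.exp (f y)) P) :
    (ENNReal.ofReal (∫ y, Real.exp (f y) ∂P))⁻¹ •
      P.withDensity (fun y => ENNReal.ofReal (Real.exp (f y))) = P.tilted f := by
  have hpos := integral_exp_pos hint
  rw [Measure.tilted, ← withDensity_smul _ (by fun_prop)]
  congr 1
  ext y
  rw [Pi.smul_apply, smul_eq_mul, ENNReal.ofReal_div_of_pos hpos, div_eq_mul_inv, mul_comm]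

lemma integrable_llr_tilted_self {Y : Type*} [MeasurableSpace Y] {P : Measure Y}
    [IsProbabilityMeasure P] {f : Y → ℝ} (hint : Integrable (fun y => Real.exp (f y)) P)
    (hf : Integrable f (P.tilted f)) :
    Integrable (llr (P.tilted f) P) (P.tilted f) := by
  have := isProbabilityMeasure_tilted hint
  refine (hf.sub (integrable_const (Real.log (∫ y, Real.exp (f y) ∂P)))).congr ?_
  filter_upwards [(tilted_absolutelyContinuous P f).ae_le (log_rnDeriv_tilted_left_self hint)]
    with y hy
  exact hy.symm

lemma toReal_klDiv_tilted_right {Y : Type*} [MeasurableSpace Y] {P Q : Measure Y}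
    [IsProbabilityMeasure P] [IsProbabilityMeasure Q] {f : Y → ℝ} (hQP : Q ≪ P)
    (hint : Integrable (fun y => Real.exp (f y)) P) (hf : Integrable f Q)
    (hllr : Integrable (llr Q P) Q) :
    (InformationTheory.klDiv Q (P.tilted f)).toReal =
      ∫ y, llr Q P y ∂Q - ∫ y, f y ∂Q + Real.log (∫ y, Real.exp (f y) ∂P) := by
  have := isProbabilityMeasure_tilted hint
  rw [InformationTheory.toReal_klDiv_of_measure_eq
    (hQP.trans (absolutelyContinuous_tilted hint)) (by simp),
    integral_llr_tilted_right hQP hf hint hllr]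

/-- The exponentially tilted measure `P_I(A) = (1/Z)·∫_A e^{−h} dP` is the
unique minimizer of the cumulative loss `λ ↦ ∫ h dλ + D(λ,P)` over probability measures
`λ ≪ P` (with `h` λ-integrable): the loss is `≥ −ln(Z)`, with equality iff `λ = P_I`. -/
theorem tilted_measure_unique_minimizer
    {Y : Type} [MeasurableSpace Y] (P : Measure Y) [IsProbabilityMeasure P]
    (h : Y → ℝ) (hmeas : Measurable h)
    (hint : Integrable (fun y => Real.exp (-h y)) P)
    (Z : ℝ) (hZdef : Z = ∫ y, Real.exp (-h y) ∂P) (hZpos : 0 < Z)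
    (PI : Measure Y)
    (hPIdef : PI = (ENNReal.ofReal Z)⁻¹ •
      P.withDensity (fun y => ENNReal.ofReal (Real.exp (-h y)))) :
    ∀ (lam : Measure Y), IsProbabilityMeasure lam → lam ≪ P → Integrable h lam →
      ((-Real.log Z : ℝ) : EReal) ≤ ((∫ y, h y ∂lam : ℝ) : EReal) + KLdiv lam P ∧
      (((∫ y, h y ∂lam : ℝ) : EReal) + KLdiv lam P = ((-Real.log Z : ℝ) : EReal)
        ↔ lam = PI) := by
  intro lam _ hac hlam
  have hneg : Integrable (fun y => -h y) lam := hlam.neg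
  have hPI : PI = P.tilted fun y => -h y := by
    rw [hPIdef, hZdef]
    exact smul_withDensity_exp_eq_tilted hmeas.neg hint
  have := isProbabilityMeasure_tilted hint
  by_cases hllr : Integrable (llr lam P) lam
  · have hKL : KLdiv lam P = ((∫ y, llr lam P y ∂lam : ℝ) : EReal) := if_pos ⟨hac, hllr⟩
    have hkl := toReal_klDiv_tilted_right hac hint hneg hllr
    rw [← hPI, ← hZdef, integral_neg] at hkl
    have hnonneg : 0 ≤ (InformationTheory.klDiv lam PI).toReal := ENNReal.toReal_nonneg
    rw [hKL, ← EReal.coe_add, EReal.coe_le_coe_iff, EReal.coe_eq_coe_iff]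
    refine ⟨by linarith, fun heq => ?_, fun heq => ?_⟩
    · have hne : InformationTheory.klDiv lam PI ≠ ⊤ := by
        rw [hPI]
        exact InformationTheory.klDiv_ne_top (hac.trans (absolutelyContinuous_tilted hint))
          (integrable_llr_tilted_right hac hneg hllr hint)
      have hzero : (InformationTheory.klDiv lam PI).toReal = 0 := by linarith
      rw [hPI] at hne hzero ⊢
      exact InformationTheory.klDiv_eq_zero_iff.mp
        (((ENNReal.toReal_eq_zero_iff _).mp hzero).resolve_right hne)
    · rw [← heq, InformationTheory.klDiv_self, ENNReal.toReal_zero] at hkl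
      linarith
  · have hKL : KLdiv lam P = ⊤ := if_neg fun hc => hllr hc.2
    rw [hKL, EReal.coe_add_top]
    refine ⟨le_top, fun heq => absurd heq.symm (EReal.coe_ne_top _), fun heq => ?_⟩
    rw [hPI] at heq
    subst heq
    exact absurd (integrable_llr_tilted_self hint hneg) hllr
end

section
/- Let (𝕐, 𝒴) be a measurable space, P a probability measure on 𝒴, and h_I, h_J : 𝕐 → ℝ measurable functions such that 0 < ∫ e^{−h_I} dP < ∞ and 0 < ∫ e^{−h_I−h_J} dP < ∞. Define P_I(A) = ∫_A e^{−h_I} dP / ∫ e^{−h_I} dP. Then 0 < ∫ e^{−h_J} dP_I < ∞, and for every A ∈ 𝒴, ∫_A e^{−h_I−h_J} dP / ∫ e^{−h_I−h_J} dP = ∫_A e^{−h_J} dP_I / ∫ e^{−h_J} dP_I. That is, updating P with the combined loss h_{IJ} = h_I + h_J yields the same probability measure as first updating P with h_I and then updating P_I with h_J: P_{IJ} = (P_I)_J. -/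
open MeasureTheory

/-- The tilted measure as a normalised measure with density `exp ∘ f`. -/
lemma tilted_eq_inv_smul_withDensity {α : Type*} [MeasurableSpace α] {μ : Measure α}
    {f : α → ℝ} (hpos : 0 < ∫ x, Real.exp (f x) ∂μ) :
    μ.tilted f = (ENNReal.ofReal (∫ x, Real.exp (f x) ∂μ))⁻¹ •
      μ.withDensity (fun x => ENNReal.ofReal (Real.exp (f x))) := by
  rw [← withDensity_smul' _ _ (ENNReal.inv_ne_top.2 (ENNReal.ofReal_pos.2 hpos).ne')]
  refine congrArg μ.withDensity (funext fun x => ?_)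
  rw [Pi.smul_apply, smul_eq_mul, ENNReal.ofReal_div_of_pos hpos, ENNReal.div_eq_inv_mul]

/-- The integral of `exp (g x)` over a measurable set under a tilted measure. -/
lemma setIntegral_exp_tilted {α : Type*} [MeasurableSpace α] {μ : Measure α}
    (f g : α → ℝ) {s : Set α} (hs : MeasurableSet s) :
    ∫ x in s, Real.exp (g x) ∂(μ.tilted f)
      = (∫ x in s, Real.exp (f x + g x) ∂μ) / ∫ x, Real.exp (f x) ∂μ := by
  simp_rw [setIntegral_tilted' _ _ hs, smul_eq_mul, div_mul_eq_mul_div, ← Real.exp_add,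
    integral_div]

/-- Coherence of the exponential-tilting update: updating `P` with the
combined loss `h_I + h_J` yields the same probability measure as first updating `P`
with `h_I` (obtaining `P_I`) and then updating `P_I` with `h_J`. -/
theorem tilting_update_coherence
    {Y : Type} [MeasurableSpace Y] (P : Measure Y) [IsProbabilityMeasure P]
    (hI hJ : Y → ℝ) (hImeas : Measurable hI) (hJmeas : Measurable hJ)
    (hint1 : Integrable (fun y => Real.exp (-hI y)) P)
    (hpos1 : 0 < ∫ y, Real.exp (-hI y) ∂P)
    (hint2 : Integrable (fun y => Real.exp (-hI y - hJ y)) P)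
    (hpos2 : 0 < ∫ y, Real.exp (-hI y - hJ y) ∂P)
    (PI : Measure Y)
    (hPIdef : PI = (ENNReal.ofReal (∫ y, Real.exp (-hI y) ∂P))⁻¹ •
      P.withDensity (fun y => ENNReal.ofReal (Real.exp (-hI y)))) :
    Integrable (fun y => Real.exp (-hJ y)) PI ∧
    0 < ∫ y, Real.exp (-hJ y) ∂PI ∧
    ∀ A : Set Y, MeasurableSet A →
      (∫ y in A, Real.exp (-hI y - hJ y) ∂P) / (∫ y, Real.exp (-hI y - hJ y) ∂P)
        = (∫ y in A, Real.exp (-hJ y) ∂PI) / (∫ y, Real.exp (-hJ y) ∂PI) := by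
  simp only [sub_eq_add_neg] at hint2 hpos2 ⊢
  have hPI : PI = P.tilted (fun y => -hI y) :=
    hPIdef.trans (tilted_eq_inv_smul_withDensity hpos1).symm
  subst hPI
  have htotal : ∫ y, Real.exp (-hJ y) ∂(P.tilted fun y => -hI y)
      = (∫ y, Real.exp (-hI y + -hJ y) ∂P) / ∫ y, Real.exp (-hI y) ∂P :=
    integral_exp_tilted _ _
  refine ⟨?_, ?_, fun A hA => ?_⟩
  · simpa only [integrable_tilted_iff hint1, smul_eq_mul, ← Real.exp_add] using hint2
  · exact htotal ▸ div_pos hpos2 hpos1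
  · rw [htotal, setIntegral_exp_tilted _ _ hA, div_div_div_cancel_right₀ hpos1.ne']
end
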